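/- arXiv:1107.0563 — 3 statements merged into one kernel-verified Lean document; each statement's English description precedes it below -/
import Mathlib

section
/- Let I ⊆ S and I' ⊆ S' be squarefree monomial ideals of polynomial rings S, S' over a field K with μ(I) = μ(I') = μ. Suppose there is a bijection σ from the vertex set of H(I) to the vertex set of H(I') (both equal to {1,…,μ} after labeling the generators) such that σ(F) ∈ H(I') for every face F ∈ H(I). Then ara I ≤ ara I'. -/
/-!
Statement 2 (Proposition `claim:hgraph`): Let `I ⊆ S` and `I' ⊆ S'` be
squarefree monomial ideals of polynomial rings over a field `K` with
`μ(I) = μ(I') = μ`.  If there is a bijection `σ` of the vertex set `{1,…,μ}`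
of `H(I)` with the vertex set of `H(I')` carrying every face of `H(I)` to a
face of `H(I')`, then `ara I ≤ ara I'`.

A squarefree monomial ideal with `μ` minimal monomial generators is
presented by the supports `A i` of its generators (minimality = no support
contained in another).  The hypergraph `H(I)` on `{1,…,μ}` consists of the
nonempty sets `{j | x_i divides m_j}` for the variables `x_i`.
-/

open MvPolynomial

universe u

/-- The arithmetical rank of an ideal. -/
noncomputable def ara {R : Type*} [CommRing R] (I : Ideal R) : ℕ :=
  sInf {r : ℕ | ∃ a : Fin r → R, (Ideal.span (Set.range a)).radical = I.radical}

/-- The hypergraph of a squarefree monomial ideal whose minimal generators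
have supports `A i`: the faces are the nonempty sets
`{j | variable i divides the j-th generator}`. -/
def hypFaces {n μ : ℕ} (A : Fin μ → Finset (Fin n)) : Set (Finset (Fin μ)) :=
  {F | F.Nonempty ∧ ∃ i : Fin n, F = Finset.univ.filter (fun j => i ∈ A j)}

theorem radical_map_eq_of_radical_eq {R S : Type*} [CommRing R] [CommRing S] (f : R →+* S)
    {I J : Ideal R} (h : I.radical = J.radical) : (I.map f).radical = (J.map f).radical := by
  have key : ∀ {I J : Ideal R}, I.radical = J.radical →
      (I.map f).radical ≤ (J.map f).radical := fun {I J} h =>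
    Ideal.radical_le_radical_iff.2 <|
      (Ideal.map_mono (Ideal.le_radical.trans h.le)).trans (Ideal.map_radical_le f)
  exact le_antisymm (key h) (key h.symm)

/-- The arithmetical rank of a finitely generated ideal does not increase under extension
along a ring homomorphism. -/
theorem ara_map_le {R S : Type*} [CommRing R] [CommRing S] (f : R →+* S) {I : Ideal R}
    (hI : I.FG) : ara (I.map f) ≤ ara I := by
  have hne : {r : ℕ | ∃ a : Fin r → R,
      (Ideal.span (Set.range a)).radical = I.radical}.Nonempty := by
    obtain ⟨r, a, ha⟩ := Submodule.fg_iff_exists_fin_generating_family.1 hI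
    exact ⟨r, a, congrArg Ideal.radical ha⟩
  obtain ⟨a, ha⟩ : ∃ a : Fin (ara I) → R, (Ideal.span (Set.range a)).radical = I.radical :=
    Nat.sInf_mem hne
  suffices h : ∃ b : Fin (ara I) → S, (Ideal.span (Set.range b)).radical = (I.map f).radical from
    Nat.sInf_le h
  refine ⟨f ∘ a, ?_⟩
  rw [Set.range_comp, ← Ideal.map_span]
  exact radical_map_eq_of_radical_eq f ha

/-- If the faces of the first hypergraph are carried to faces of the second, each variable of
the first ring that occurs in a generator can be matched with a variable of the second ring
dividing exactly the corresponding generators. -/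
theorem exists_variable_matching {n n' μ : ℕ} {A : Fin μ → Finset (Fin n)}
    {A' : Fin μ → Finset (Fin n')} {σ : Equiv.Perm (Fin μ)}
    (hσ : ∀ F ∈ hypFaces A, F.image σ ∈ hypFaces A') :
    ∃ g : Fin n → Option (Fin n'), ∀ i j, i ∈ A j ↔ ∃ k ∈ A' (σ j), g i = some k := by
  suffices h : ∀ i, ∃ o : Option (Fin n'), ∀ j, i ∈ A j ↔ ∃ k ∈ A' (σ j), o = some k from
    ⟨fun i => (h i).choose, fun i => (h i).choose_spec⟩
  intro i
  rcases (Finset.univ.filter fun j => i ∈ A j).eq_empty_or_nonempty with he | hn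
  · refine ⟨none, fun j => ?_⟩
    simpa using Finset.filter_eq_empty_iff.1 he (Finset.mem_univ j)
  · obtain ⟨-, k, hk⟩ := hσ _ ⟨hn, i, rfl⟩
    refine ⟨some k, fun j => ?_⟩
    have := Finset.ext_iff.1 hk (σ j)
    simpa using this

theorem ara_le_ara_of_hypergraph_subset
    (K : Type u) [Field K] (n n' μ : ℕ)
    (A : Fin μ → Finset (Fin n)) (A' : Fin μ → Finset (Fin n'))
    (hmin : ∀ i j : Fin μ, i ≠ j → ¬ A i ⊆ A j)
    (hmin' : ∀ i j : Fin μ, i ≠ j → ¬ A' i ⊆ A' j)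
    (I : Ideal (MvPolynomial (Fin n) K))
    (hI : I = Ideal.span (Set.range fun i : Fin μ =>
      ∏ v ∈ A i, (X v : MvPolynomial (Fin n) K)))
    (I' : Ideal (MvPolynomial (Fin n') K))
    (hI' : I' = Ideal.span (Set.range fun i : Fin μ =>
      ∏ v ∈ A' i, (X v : MvPolynomial (Fin n') K)))
    (σ : Equiv.Perm (Fin μ))
    (hσ : ∀ F ∈ hypFaces A, F.image σ ∈ hypFaces A') :
    ara I ≤ ara I' := by
  obtain ⟨g, hg⟩ := exists_variable_matching hσ
  let φ : MvPolynomial (Fin n') K →+* MvPolynomial (Fin n) K :=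
    (aeval fun k => ∏ i with g i = some k, X i : _ →ₐ[K] _).toRingHom
  have hφ : ∀ j, φ (∏ k ∈ A' (σ j), X k) = ∏ i ∈ A j, X i := by
    intro j
    have hA : A j = (A' (σ j)).biUnion fun k => Finset.univ.filter fun i => g i = some k := by
      ext i
      simp [hg]
    rw [hA, Finset.prod_biUnion, map_prod]
    · exact Finset.prod_congr rfl fun k _ => aeval_X _ k
    · intro k _ l _ hkl
      refine Finset.disjoint_left.2 fun i hi hi' => hkl ?_
      simp only [Finset.mem_filter, Finset.mem_univ, true_and] at hi hi'
      exact Option.some_injective _ (hi.symm.trans hi')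
  have hmap : I'.map φ = I := by
    rw [hI, hI', Ideal.map_span, ← Set.range_comp, ← σ.surjective.range_comp]
    exact congrArg (fun m => Ideal.span (Set.range m)) (funext hφ)
  rw [← hmap]
  exact ara_map_le φ (IsNoetherian.noetherian I')
end

section
/- Let K be a field and I a squarefree monomial ideal of S = K[x_1,…,x_n] with associated hypergraph H = H(I). Then pd_S S/I = μ(I) if and only if B(H) = V(H), i.e., {v} ∈ H for every vertex v of H. -/
/-!
Statement 3 (Proposition `claim:mu`): for a squarefree monomial ideal `I`
with associated hypergraph `H = H(I)`, one has `pd_S S/I = μ(I)` if and only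
if `B(H) = V(H)`, i.e. every vertex `v` of `H` satisfies `{v} ∈ H`.
-/

open CategoryTheory MvPolynomial

universe u

/-- The projective dimension (possibly `⊤`) of a module `M` over a commutative
ring `R`, via the standard characterization by vanishing of `Ext` groups. -/
noncomputable def pdim (R : Type u) [CommRing R] (M : ModuleCat.{u} R) : ℕ∞ :=
  sInf {n : ℕ∞ | ∀ k : ℕ, n < (k : ℕ∞) → ∀ N : ModuleCat.{u} R,
    Subsingleton (((Ext R (ModuleCat.{u} R) k).obj (Opposite.op M)).obj N)}

/-- The derived-functor `Ext` and `Abelian.Ext` vanish simultaneously in positive degrees. -/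
theorem subsingleton_ext_succ_iff {R : Type u} [CommRing R] (M N : ModuleCat.{u} R) (k : ℕ) :
    Subsingleton (((Ext R (ModuleCat.{u} R) (k + 1)).obj (Opposite.op M)).obj N) ↔
      Subsingleton (Abelian.Ext.{u} M N (k + 1)) := by
  let P := projectiveResolution M
  rw [(P.isoExt (R := R) (k + 1) N).toLinearEquiv.toEquiv.subsingleton_congr,
    ← ModuleCat.isZero_iff_subsingleton, ← HomologicalComplex.exactAt_iff_isZero_homology,
    HomologicalComplex.exactAt_iff' _ k (k + 1) (k + 2) (by simp) (by simp),
    ShortComplex.moduleCat_exact_iff]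
  constructor
  · intro h
    refine subsingleton_of_forall_eq 0 fun α => ?_
    obtain ⟨f, hf, rfl⟩ := P.extMk_surjective α (k + 2) rfl
    exact (P.extMk_eq_zero_iff f (k + 2) rfl hf k rfl).2 (h f hf)
  · intro h f hf
    exact (P.extMk_eq_zero_iff f (k + 2) rfl hf k rfl).1 (Subsingleton.elim _ _)

section ColonSequence

variable {R : Type u} [CommRing R] {I I₀ J : Ideal R} {m : R}

/-- Multiplication by `m` as a map `R ⧸ J ⟶ R ⧸ I₀`, when `J * m ⊆ I₀`. -/
noncomputable def quotMul (m : R) (h : ∀ a ∈ J, a * m ∈ I₀) :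
    ModuleCat.of R (R ⧸ J) ⟶ ModuleCat.of R (R ⧸ I₀) :=
  ModuleCat.ofHom (Submodule.mapQ J I₀ (LinearMap.mulRight R m) h)

/-- The sequence `0 → R ⧸ (I₀ : m) → R ⧸ I₀ → R ⧸ (I₀ + (m)) → 0`. -/
noncomputable def colonSequence (hJ : ∀ a, a ∈ J ↔ a * m ∈ I₀)
    (hI : I = I₀ ⊔ Ideal.span {m}) : ShortComplex (ModuleCat.{u} R) where
  X₁ := ModuleCat.of R (R ⧸ J)
  X₂ := ModuleCat.of R (R ⧸ I₀)
  X₃ := ModuleCat.of R (R ⧸ I)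
  f := quotMul m fun a => (hJ a).1
  g := ModuleCat.ofHom (Submodule.factor (hI ▸ le_sup_left : I₀ ≤ I))
  zero := by
    refine ModuleCat.hom_ext (LinearMap.ext fun x => ?_)
    obtain ⟨a, rfl⟩ := Submodule.Quotient.mk_surjective _ x
    exact (Submodule.Quotient.mk_eq_zero _).2
      (hI ▸ Ideal.mem_sup_right (Ideal.mul_mem_left _ a (Ideal.mem_span_singleton_self m)))

theorem colonSequence_shortExact (hJ : ∀ a, a ∈ J ↔ a * m ∈ I₀)
    (hI : I = I₀ ⊔ Ideal.span {m}) : (colonSequence hJ hI).ShortExact where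
  exact := by
    rw [ShortComplex.moduleCat_exact_iff]
    intro x hx
    obtain ⟨a, rfl⟩ := Submodule.Quotient.mk_surjective _ x
    have ha : a ∈ I := (Submodule.Quotient.mk_eq_zero _).1 hx
    rw [hI] at ha
    obtain ⟨b, hb, c, hc, rfl⟩ := Submodule.mem_sup.1 ha
    obtain ⟨d, rfl⟩ := Ideal.mem_span_singleton'.1 hc
    refine ⟨Submodule.Quotient.mk d, ?_⟩
    refine (Submodule.Quotient.eq _).2 ?_
    simpa using I₀.neg_mem hb
  mono_f := by
    rw [ModuleCat.mono_iff_injective, injective_iff_map_eq_zero]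
    intro x hx
    obtain ⟨a, rfl⟩ := Submodule.Quotient.mk_surjective _ x
    exact (Submodule.Quotient.mk_eq_zero _).2
      ((hJ a).2 ((Submodule.Quotient.mk_eq_zero _).1 hx))
  epi_g := by
    rw [ModuleCat.epi_iff_surjective]
    exact Submodule.factor_surjective (hI ▸ le_sup_left : I₀ ≤ I)

/-- If `y` kills `N`, then precomposition with `y • f` is zero on `Ext(-, N)`. -/
theorem mk₀_smul_comp_eq_zero {X Y N : ModuleCat.{u} R} (f : X ⟶ Y) (y : R)
    (hy : ∀ x : N, y • x = 0) {k : ℕ} (α : Abelian.Ext.{u} Y N k) :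
    (Abelian.Ext.mk₀ (y • f)).comp α (zero_add k) = 0 := by
  have h : y • 𝟙 N = 0 := by
    refine ModuleCat.hom_ext (LinearMap.ext fun x => ?_)
    exact hy x
  rw [Abelian.Ext.mk₀_smul, Abelian.Ext.smul_comp, ← Abelian.Ext.comp_smul,
    Abelian.Ext.smul_eq_comp_mk₀, h, Abelian.Ext.mk₀_zero, Abelian.Ext.comp_zero,
    Abelian.Ext.comp_zero]

end ColonSequence

section SquarefreeIdeal

variable (K : Type u) [Field K] {n : ℕ} {ι : Type*}

/-- The squarefree monomial with support `T`. -/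
noncomputable abbrev sqfreeMonomial (T : Finset (Fin n)) : MvPolynomial (Fin n) K :=
  ∏ v ∈ T, X v

/-- The ideal generated by the squarefree monomials with supports `A j`, `j ∈ s`. -/
noncomputable def sqfreeIdeal (A : ι → Finset (Fin n)) (s : Finset ι) :
    Ideal (MvPolynomial (Fin n) K) :=
  Ideal.span ((fun j => sqfreeMonomial K (A j)) '' (s : Set ι))

variable {K}

theorem sqfreeMonomial_eq (T : Finset (Fin n)) :
    sqfreeMonomial K T = monomial (∑ v ∈ T, Finsupp.single v 1) 1 := by
  rw [monomial_sum_one]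
  rfl

theorem sum_single_apply (T : Finset (Fin n)) (v : Fin n) :
    (∑ w ∈ T, Finsupp.single w 1 : Fin n →₀ ℕ) v = if v ∈ T then 1 else 0 := by
  simp [Finsupp.finsetSum_apply, Finsupp.single_apply]

theorem mem_sqfreeIdeal {A : ι → Finset (Fin n)} {s : Finset ι} {a : MvPolynomial (Fin n) K} :
    a ∈ sqfreeIdeal K A s ↔ ∀ x ∈ a.support, ∃ j ∈ s, ∀ v ∈ A j, x v ≠ 0 := by
  have h : (fun j => sqfreeMonomial K (A j)) '' (s : Set ι) = (fun e => monomial e (1 : K)) ''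
      ((fun j => ∑ v ∈ A j, Finsupp.single v 1) '' (s : Set ι)) := by
    simp only [Set.image_image, sqfreeMonomial_eq]
  rw [sqfreeIdeal, h, mem_ideal_span_monomial_image]
  refine forall₂_congr fun x _ => ?_
  simp only [Set.exists_mem_image, Finset.mem_coe, Finsupp.le_def, sum_single_apply]
  refine exists_congr fun j => and_congr_right fun _ => forall_congr' fun v => ?_
  split_ifs with hv <;> simp [hv, Nat.one_le_iff_ne_zero]

theorem mem_sqfreeIdeal_sdiff (A : ι → Finset (Fin n)) (s : Finset ι) (T : Finset (Fin n))
    (a : MvPolynomial (Fin n) K) :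
    a ∈ sqfreeIdeal K (fun j => A j \ T) s ↔ a * sqfreeMonomial K T ∈ sqfreeIdeal K A s := by
  rw [mem_sqfreeIdeal, mem_sqfreeIdeal, sqfreeMonomial_eq]
  constructor
  · intro h x hx
    rw [mem_support_iff, coeff_mul_monomial'] at hx
    split_ifs at hx with hle
    · obtain ⟨j, hj, hv⟩ := h _ (mem_support_iff.2 (by simpa using hx))
      refine ⟨j, hj, fun v hvj => ?_⟩
      have h1 := hle v
      rw [sum_single_apply] at h1
      by_cases hvT : v ∈ T
      · rw [if_pos hvT] at h1
        omega
      · have h2 := hv v (Finset.mem_sdiff.2 ⟨hvj, hvT⟩)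
        rw [Finsupp.tsub_apply, sum_single_apply, if_neg hvT] at h2
        exact h2
    · exact absurd rfl hx
  · intro h x hx
    obtain ⟨j, hj, hv⟩ := h (x + ∑ v ∈ T, Finsupp.single v 1) (by
      rw [mem_support_iff, coeff_mul_monomial, mul_one]
      exact mem_support_iff.1 hx)
    refine ⟨j, hj, fun v hvj => ?_⟩
    obtain ⟨hvA, hvT⟩ := Finset.mem_sdiff.1 hvj
    have h2 := hv v hvA
    rwa [Finsupp.add_apply, sum_single_apply, if_neg hvT] at h2

theorem sqfreeIdeal_insert [DecidableEq ι] (A : ι → Finset (Fin n)) (j : ι) (s : Finset ι) :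
    sqfreeIdeal K A (insert j s) = sqfreeIdeal K A s ⊔ Ideal.span {sqfreeMonomial K (A j)} := by
  rw [sqfreeIdeal, Finset.coe_insert, Set.image_insert_eq, Ideal.span_insert, sup_comm]
  rfl

variable (K) in
/-- The quotient of the polynomial ring by `sqfreeIdeal K A s`. -/
noncomputable abbrev sqfreeQuot (A : ι → Finset (Fin n)) (s : Finset ι) :
    ModuleCat.{u} (MvPolynomial (Fin n) K) :=
  ModuleCat.of _ (MvPolynomial (Fin n) K ⧸ sqfreeIdeal K A s)

/-- The short exact sequence obtained by adding the generator indexed by `j`. -/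
theorem insert_shortExact [DecidableEq ι] (A : ι → Finset (Fin n)) (j : ι) (s : Finset ι) :
    (colonSequence (mem_sqfreeIdeal_sdiff (K := K) A s (A j))
      (sqfreeIdeal_insert A j s)).ShortExact :=
  colonSequence_shortExact _ _

theorem hasProjectiveDimensionLT_insert [DecidableEq ι] (A : ι → Finset (Fin n)) (j : ι)
    (s : Finset ι) (k : ℕ)
    (h₁ : HasProjectiveDimensionLT (sqfreeQuot K (fun i => A i \ A j) s) k)
    (h₂ : HasProjectiveDimensionLT (sqfreeQuot K A s) (k + 1)) :
    HasProjectiveDimensionLT (sqfreeQuot K A (insert j s)) (k + 1) :=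
  (insert_shortExact A j s).hasProjectiveDimensionLT_X₃ k h₁ h₂

theorem sqfreeIdeal_empty (A : ι → Finset (Fin n)) : sqfreeIdeal K A ∅ = ⊥ := by
  simp [sqfreeIdeal]

theorem hasProjectiveDimensionLE_sqfreeQuot [DecidableEq ι] (A : ι → Finset (Fin n))
    (s : Finset ι) : HasProjectiveDimensionLE (sqfreeQuot K A s) s.card := by
  induction s using Finset.induction_on generalizing A with
  | empty =>
    have : Module.Projective (MvPolynomial (Fin n) K)
        (MvPolynomial (Fin n) K ⧸ sqfreeIdeal K A ∅) :=
      Module.Projective.of_equiv (Submodule.quotEquivOfEqBot _ (sqfreeIdeal_empty A)).symm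
    have : Projective (sqfreeQuot K A ∅) := inferInstance
    rw [Finset.card_empty]
    exact (projective_iff_hasProjectiveDimensionLE_zero _).1 this
  | insert j s hj ih =>
    rw [Finset.card_insert_of_notMem hj]
    have h := ih A
    exact hasProjectiveDimensionLT_insert A j s _ (ih _)
      (hasProjectiveDimensionLT_of_ge _ (s.card + 1) _ (Nat.le_succ _))

/-- A generator dividing the least common multiple of the others lowers the bound by one. -/
theorem hasProjectiveDimensionLE_sqfreeQuot_insert [DecidableEq ι] (A : ι → Finset (Fin n))
    {v : ι} {s : Finset ι} (hv : v ∉ s) (hA : ∀ i ∈ A v, ∃ j ∈ s, i ∈ A j) :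
    HasProjectiveDimensionLE (sqfreeQuot K A (insert v s)) s.card := by
  induction s using Finset.induction_on generalizing A with
  | empty =>
    have hv0 : A v = ∅ := Finset.eq_empty_of_forall_notMem fun i hi => by simpa using hA i hi
    have htop : sqfreeIdeal K A (insert v ∅) = ⊤ := by
      rw [sqfreeIdeal_insert, sqfreeMonomial, hv0, Finset.prod_empty, Ideal.span_singleton_one,
        sup_top_eq]
    have : Subsingleton (sqfreeQuot K A (insert v ∅)) :=
      Submodule.Quotient.subsingleton_iff.2 htop
    have := (ModuleCat.isZero_of_subsingleton
      (sqfreeQuot K A (insert v ∅))).hasProjectiveDimensionLT_zero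
    exact hasProjectiveDimensionLT_of_ge _ 0 _ (Nat.zero_le _)
  | insert j s hj ih =>
    rw [Finset.mem_insert, not_or] at hv
    have h₂ := hasProjectiveDimensionLE_sqfreeQuot (K := K) A (insert v s)
    rw [Finset.card_insert_of_notMem hv.2] at h₂
    rw [Finset.card_insert_of_notMem hj, Finset.insert_comm]
    refine hasProjectiveDimensionLT_insert A j _ _ (ih _ hv.2 fun i hi => ?_) h₂
    rw [Finset.mem_sdiff] at hi
    obtain ⟨w, hw, hiw⟩ := hA i hi.1
    obtain rfl | hw := Finset.mem_insert.1 hw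
    · exact absurd hiw hi.2
    · exact ⟨w, hw, Finset.mem_sdiff.2 ⟨hiw, hi.2⟩⟩

/-- When each generator has a private variable, the top `Ext` into a module killed by the
variables does not vanish. -/
theorem nontrivial_ext_sqfreeQuot [DecidableEq ι] (N : ModuleCat.{u} (MvPolynomial (Fin n) K))
    [Nontrivial N] (hN : ∀ (i : Fin n) (x : N), (X i : MvPolynomial (Fin n) K) • x = 0)
    (A : ι → Finset (Fin n)) (s : Finset ι)
    (hA : ∀ v ∈ s, ∃ i ∈ A v, ∀ w ∈ s, w ≠ v → i ∉ A w) :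
    Nontrivial (Abelian.Ext.{u} (sqfreeQuot K A s) N s.card) := by
  induction s using Finset.induction_on generalizing A with
  | empty =>
    obtain ⟨x, hx⟩ := exists_ne (0 : N)
    rw [Finset.card_empty, Abelian.Ext.homEquiv₀.nontrivial_congr]
    let e := Submodule.quotEquivOfEqBot _ (sqfreeIdeal_empty (K := K) A)
    refine ⟨ModuleCat.ofHom ((LinearMap.toSpanSingleton _ N x).comp e.toLinearMap), 0,
      fun h => hx ?_⟩
    have h1 := congrArg (fun f => f.hom (e.symm 1)) h
    simpa using h1
  | insert j s hj ih =>
    obtain ⟨y, hyj, hy⟩ := hA j (Finset.mem_insert_self j s)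
    have hys : ∀ w ∈ s, y ∉ A w := fun w hw =>
      hy w (Finset.mem_insert_of_mem hw) (ne_of_mem_of_not_mem hw hj)
    have ih₂ := ih (fun i => A i \ A j) fun v hv => by
      obtain ⟨i, hiv, hi⟩ := hA v (Finset.mem_insert_of_mem hv)
      refine ⟨i, Finset.mem_sdiff.2 ⟨hiv, hi j (Finset.mem_insert_self j s)
        (ne_of_mem_of_not_mem hv hj).symm⟩, fun w hw hwv hiw => ?_⟩
      exact hi w (Finset.mem_insert_of_mem hw) hwv (Finset.mem_sdiff.1 hiw).1
    obtain ⟨α, hα⟩ := exists_ne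
      (0 : Abelian.Ext.{u} (sqfreeQuot K (fun i => A i \ A j) s) N s.card)
    rw [Finset.card_insert_of_notMem hj]
    have hS := insert_shortExact (K := K) A j s
    refine ⟨hS.extClass.comp α (add_comm _ _), 0, fun h => hα ?_⟩
    obtain ⟨β, rfl⟩ := Abelian.Ext.contravariant_sequence_exact₁ hS N α (add_comm _ _) h
    have hmul : ∀ a ∈ sqfreeIdeal K (fun i => A i \ A j) s,
        a * sqfreeMonomial K ((A j).erase y) ∈ sqfreeIdeal K A s := by
      intro a ha
      rw [← mem_sqfreeIdeal_sdiff, mem_sqfreeIdeal]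
      intro x hx
      obtain ⟨w, hw, hxw⟩ := mem_sqfreeIdeal.1 ha x hx
      refine ⟨w, hw, fun i hi => hxw i ?_⟩
      have := hys w hw
      grind
    have hf : (colonSequence (mem_sqfreeIdeal_sdiff (K := K) A s (A j))
        (sqfreeIdeal_insert A j s)).f = (X y : MvPolynomial (Fin n) K) • quotMul _ hmul := by
      refine ModuleCat.hom_ext (LinearMap.ext fun x => ?_)
      obtain ⟨a, rfl⟩ := Submodule.Quotient.mk_surjective _ x
      change Submodule.Quotient.mk (p := sqfreeIdeal K A s) (a * sqfreeMonomial K (A j)) =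
        (X y : MvPolynomial (Fin n) K) • Submodule.Quotient.mk (p := sqfreeIdeal K A s)
          (a * sqfreeMonomial K ((A j).erase y))
      rw [← Submodule.Quotient.mk_smul, sqfreeMonomial, ← Finset.mul_prod_erase _ _ hyj,
        smul_eq_mul, mul_left_comm]
    rw [hf]
    exact mk₀_smul_comp_eq_zero _ _ (hN y) β

end SquarefreeIdeal

theorem exists_nontrivial_killed_by_X (K : Type u) [Field K] (n : ℕ) :
    ∃ N : ModuleCat.{u} (MvPolynomial (Fin n) K),
    Nontrivial N ∧ ∀ (i : Fin n) (x : N), (X i : MvPolynomial (Fin n) K) • x = 0 := by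
  let I : Ideal (MvPolynomial (Fin n) K) := RingHom.ker (constantCoeff (R := K) (σ := Fin n))
  refine ⟨ModuleCat.of _ (MvPolynomial (Fin n) K ⧸ I),
    Ideal.Quotient.nontrivial_iff.2 (RingHom.ker_ne_top _), fun i x => ?_⟩
  obtain ⟨a, rfl⟩ := Submodule.Quotient.mk_surjective _ x
  refine (Submodule.Quotient.mk_eq_zero _).2 (I.mul_mem_right a ?_)
  simp [I, RingHom.mem_ker]

theorem pdim_le_of_hasProjectiveDimensionLE {R : Type u} [CommRing R] (M : ModuleCat.{u} R)
    (k : ℕ) (hM : HasProjectiveDimensionLE M k) : pdim R M ≤ k := by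
  refine sInf_le fun i hi N => ?_
  have hi : k < i := by exact_mod_cast hi
  obtain ⟨i, rfl⟩ := Nat.exists_eq_succ_of_ne_zero (Nat.ne_zero_of_lt hi)
  exact (subsingleton_ext_succ_iff M N i).2
    (HasProjectiveDimensionLT.subsingleton M (k + 1) (i + 1) hi N)

theorem le_pdim_of_nontrivial_ext {R : Type u} [CommRing R] (M N : ModuleCat.{u} R) (k : ℕ)
    (h : Nontrivial (Abelian.Ext.{u} M N k)) : (k : ℕ∞) ≤ pdim R M := by
  refine le_sInf fun m hm => ?_
  obtain _ | k := k
  · simp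
  · by_contra! hlt
    have := (subsingleton_ext_succ_iff M N k).1 (hm (k + 1) hlt N)
    exact not_subsingleton _ this

theorem pdim_eq_mu_iff
    (K : Type u) [Field K] (n μ : ℕ)
    (A : Fin μ → Finset (Fin n))
    (hmin : ∀ i j : Fin μ, i ≠ j → ¬ A i ⊆ A j)
    (I : Ideal (MvPolynomial (Fin n) K))
    (hI : I = Ideal.span (Set.range fun i : Fin μ =>
      ∏ v ∈ A i, (X v : MvPolynomial (Fin n) K))) :
    pdim (MvPolynomial (Fin n) K)
        (ModuleCat.of (MvPolynomial (Fin n) K) (MvPolynomial (Fin n) K ⧸ I)) = (μ : ℕ∞)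
      ↔ ∀ v : Fin μ, ({v} : Finset (Fin μ)) ∈ hypFaces A := by
  have hJ : I = sqfreeIdeal K A Finset.univ := by
    rw [hI, sqfreeIdeal, Finset.coe_univ, Set.image_univ]
  subst hJ
  have hface : (∀ v : Fin μ, ({v} : Finset (Fin μ)) ∈ hypFaces A) ↔
      ∀ v : Fin μ, ∃ i ∈ A v, ∀ w, w ≠ v → i ∉ A w := by
    refine forall_congr' fun v => ?_
    simp only [hypFaces, Set.mem_ofPred_eq, Finset.singleton_nonempty, true_and, Finset.ext_iff,
      Finset.mem_singleton, Finset.mem_filter, Finset.mem_univ]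
    refine exists_congr fun i => ⟨fun h => ⟨(h v).1 rfl, fun w hw hi => hw ((h w).2 hi)⟩,
      fun ⟨hi, h⟩ w => ⟨fun hw => hw ▸ hi, fun hw => ?_⟩⟩
    exact not_imp_not.1 (h w) hw
  rw [hface]
  constructor
  · intro h
    by_contra! hcon
    obtain ⟨v, hv⟩ := hcon
    have hle := hasProjectiveDimensionLE_sqfreeQuot_insert (K := K) A
      (Finset.notMem_erase v Finset.univ) fun i hi => by
        obtain ⟨w, hwv, hiw⟩ := hv i hi
        exact ⟨w, Finset.mem_erase.2 ⟨hwv, Finset.mem_univ w⟩, hiw⟩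
    rw [Finset.insert_erase (Finset.mem_univ v), Finset.card_erase_of_mem (Finset.mem_univ v),
      Finset.card_fin] at hle
    have h1 := pdim_le_of_hasProjectiveDimensionLE _ (μ - 1) hle
    rw [h, Nat.cast_le] at h1
    have := v.pos
    omega
  · intro h
    obtain ⟨N, _, hN⟩ := exists_nontrivial_killed_by_X K n
    have hle := hasProjectiveDimensionLE_sqfreeQuot (K := K) A Finset.univ
    have hge := nontrivial_ext_sqfreeQuot N hN A Finset.univ fun v _ => by
      obtain ⟨i, hi, hw⟩ := h v
      exact ⟨i, hi, fun w _ => hw w⟩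
    rw [Finset.card_fin] at hle hge
    exact le_antisymm (pdim_le_of_hasProjectiveDimensionLE _ μ hle)
      (le_pdim_of_nontrivial_ext _ N μ hge)
end

section
/- Let m_1,…,m_μ be squarefree monomials in the variables x_1,…,x_n forming a minimal generating set, and for a field K let I_K = (m_1,…,m_μ) ⊆ K[x_1,…,x_n]. Then for any two fields K and K', the equality pd_{K[x_1,…,x_n]} K[x_1,…,x_n]/I_K = μ − 1 holds if and only if pd_{K'[x_1,…,x_n]} K'[x_1,…,x_n]/I_{K'} = μ − 1 holds; that is, the condition pd_S S/I = μ(I) − 1 is independent of the base field. -/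
/-!
Statement 5 (Corollary `claim:char-free`): the condition `pd_S S/I = μ(I) − 1`
for a squarefree monomial ideal given by a fixed minimal family of squarefree
monomial generators is independent of the base field.
-/

open CategoryTheory MvPolynomial

universe u v

/-- The squarefree monomial ideal of `K[x_1,…,x_n]` generated by the
monomials with supports `A i`, `i = 1,…,μ`. -/
noncomputable def sqfIdeal (K : Type*) [Field K] {n μ : ℕ}
    (A : Fin μ → Finset (Fin n)) : Ideal (MvPolynomial (Fin n) K) :=
  Ideal.span (Set.range fun i : Fin μ => ∏ v ∈ A i, (X v : MvPolynomial (Fin n) K))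

section
variable {R : Type u} [CommRing R] {T : ℕ → Type u} [∀ k, AddCommGroup (T k)] [∀ k, Module R (T k)]
  [∀ k, Module.Projective R (T k)] {M : Type u} [AddCommGroup M] [Module R M]
  (d : ∀ k, T (k + 1) →ₗ[R] T k) (π : T 0 →ₗ[R] M)

/-- The chain complex of modules with differentials `d`. -/
noncomputable def resolutionComplex (hd : ∀ k, Function.Exact (d (k + 1)) (d k)) :
    ChainComplex (ModuleCat.{u} R) ℕ :=
  ChainComplex.of (fun k => ModuleCat.of R (T k)) (fun k => ModuleCat.ofHom (d k))
    (fun k => by rw [← ModuleCat.ofHom_comp, (hd k).linearMap_comp_eq_zero]; rfl)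

variable {d} {π}
omit [∀ k, Module.Projective R (T k)] in
lemma resolutionComplex_d (hd : ∀ k, Function.Exact (d (k + 1)) (d k)) (k : ℕ) :
    (resolutionComplex d hd).d (k + 1) k = ModuleCat.ofHom (d k) :=
  by exact ChainComplex.of_d (fun k => ModuleCat.of R (T k)) (fun k => ModuleCat.ofHom (d k)) k

omit [∀ k, Module.Projective R (T k)] in
lemma resolutionComplex_d_apply (hd : ∀ k, Function.Exact (d (k + 1)) (d k)) (k : ℕ)
    (x : T (k + 1)) : ((resolutionComplex d hd).d (k + 1) k).hom x = d k x :=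
  congrArg (fun f => ModuleCat.Hom.hom f x) (resolutionComplex_d hd k)

/-- An exact augmented complex of projective modules is a projective resolution. -/
noncomputable def resolutionOfExact (hd : ∀ k, Function.Exact (d (k + 1)) (d k))
    (hπ : Function.Exact (d 0) π) (hsurj : Function.Surjective π) :
    ProjectiveResolution (ModuleCat.of R M) where
  complex := resolutionComplex d hd
  projective k := by
    dsimp [resolutionComplex, ChainComplex.of]
    infer_instance
  π := (ChainComplex.toSingle₀Equiv _ _).symm ⟨ModuleCat.ofHom π, by
    rw [resolutionComplex_d]
    exact (ModuleCat.ofHom_comp _ _).symm.trans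
      (by rw [hπ.linearMap_comp_eq_zero]; rfl)⟩
  quasiIso := ⟨fun m => by
    cases m with
    | zero =>
      rw [ChainComplex.quasiIsoAt₀_iff, ShortComplex.quasiIso_iff_of_zeros' _ rfl rfl rfl]
      constructor
      · rw [ShortComplex.moduleCat_exact_iff]
        intro x hx
        obtain ⟨y, hy⟩ := (hπ x).1 hx
        exact ⟨y, (resolutionComplex_d_apply hd 0 y).trans hy⟩
      · rw [ModuleCat.epi_iff_surjective]
        exact hsurj
    | succ m =>
      rw [quasiIsoAt_iff_exactAt' (hL := ChainComplex.exactAt_succ_single_obj ..),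
          HomologicalComplex.exactAt_iff' _ (m + 2) (m + 1) m (by simp) (by simp),
          ShortComplex.moduleCat_exact_iff]
      intro x hx
      obtain ⟨y, hy⟩ := (hd m x).1 ((resolutionComplex_d_apply hd m x).symm.trans hx)
      exact ⟨y, (resolutionComplex_d_apply hd (m + 1) y).trans hy⟩⟩

lemma subsingleton_Ext_succ_iff (hd : ∀ k, Function.Exact (d (k + 1)) (d k))
    (hπ : Function.Exact (d 0) π) (hsurj : Function.Surjective π) (k : ℕ) (N : ModuleCat.{u} R) :
    Subsingleton (((Ext R (ModuleCat.{u} R) (k + 1)).obj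
      (Opposite.op (ModuleCat.of R M))).obj N) ↔
    ∀ f : T (k + 1) →ₗ[R] N, f ∘ₗ d (k + 1) = 0 → ∃ g : T k →ₗ[R] N, g ∘ₗ d k = f := by
  rw [← ModuleCat.isZero_iff_subsingleton,
    ((resolutionOfExact hd hπ hsurj).isoExt (R := R) (k + 1) N).isZero_iff,
    ← HomologicalComplex.exactAt_iff_isZero_homology,
    HomologicalComplex.exactAt_iff' _ k (k + 1) (k + 2) (by simp) (by simp),
    ShortComplex.moduleCat_exact_iff]
  have e (k : ℕ) (f : T k →ₗ[R] N) :
      (resolutionComplex d hd).d (k + 1) k ≫ ModuleCat.ofHom f =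
        ModuleCat.ofHom (f ∘ₗ d k) := by
    rw [ModuleCat.ofHom_comp]
    exact congrArg (· ≫ ModuleCat.ofHom f) (resolutionComplex_d hd k)
  constructor
  · intro H f hf
    obtain ⟨g, hg⟩ := H (ModuleCat.ofHom f) ((e _ f).trans (by rw [hf]; rfl))
    exact ⟨ModuleCat.Hom.hom g,
      congrArg ModuleCat.Hom.hom ((e _ (ModuleCat.Hom.hom g)).symm.trans hg)⟩
  · intro H f hf
    obtain ⟨g, hg⟩ := H (ModuleCat.Hom.hom f)
      (congrArg ModuleCat.Hom.hom ((e _ (ModuleCat.Hom.hom f)).symm.trans hf))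
    exact ⟨ModuleCat.ofHom g, (e _ g).trans (by rw [hg]; rfl)⟩
end

section Simplex

variable {ι : Type*} [LinearOrder ι]

/-- The incidence sign of `F` in `insert i F`, which is zero if `i ∈ F`. -/
def faceSign (i : ι) (F : Finset ι) : ℤ :=
  if i ∈ F then 0 else (-1) ^ (F.filter (· < i)).card

lemma faceSign_of_mem {i : ι} {F : Finset ι} (h : i ∈ F) : faceSign i F = 0 := if_pos h

lemma faceSign_mul_self {i : ι} {F : Finset ι} (h : i ∉ F) : faceSign i F * faceSign i F = 1 := by
  rw [faceSign, if_neg h, ← mul_pow]; simp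

lemma faceSign_insert_of_lt {i j : ι} {F : Finset ι} (hij : i < j) (hi : i ∉ F) :
    faceSign j (insert i F) = -faceSign j F := by
  have : j ∈ insert i F ↔ j ∈ F := by simp [hij.ne']
  simp only [faceSign, this]
  split_ifs
  · simp
  · rw [Finset.filter_insert, if_pos hij, Finset.card_insert_of_notMem (by simp [hi]), pow_succ]
    simp

lemma faceSign_insert_of_gt {i j : ι} {F : Finset ι} (hij : j < i) :
    faceSign j (insert i F) = faceSign j F := by
  have : j ∈ insert i F ↔ j ∈ F := by simp [hij.ne]
  simp only [faceSign, this, Finset.filter_insert, if_neg hij.not_gt]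

lemma faceSign_mul_insert (i j : ι) (F : Finset ι) :
    faceSign i F * faceSign j (insert i F) = -(faceSign j F * faceSign i (insert j F)) := by
  by_cases hi : i ∈ F
  · simp [faceSign_of_mem, hi]
  by_cases hj : j ∈ F
  · simp [faceSign_of_mem, hj]
  rcases lt_trichotomy i j with h | rfl | h
  · rw [faceSign_insert_of_lt h hi, faceSign_insert_of_gt h]; ring
  · simp [faceSign_of_mem]
  · rw [faceSign_insert_of_lt h hj, faceSign_insert_of_gt h]; ring

lemma faceSign_insert_mul_insert {i j : ι} (hij : i ≠ j) {F : Finset ι} (hi : i ∉ F) :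
    faceSign j (insert i F) * faceSign i (insert j F) = -(faceSign i F * faceSign j F) := by
  by_cases hj : j ∈ F
  · simp [faceSign_of_mem, hj]
  rcases hij.lt_or_gt with h | h
  · rw [faceSign_insert_of_lt h hi, faceSign_insert_of_gt h]; ring
  · rw [faceSign_insert_of_lt h hj, faceSign_insert_of_gt h]; ring

variable [Fintype ι] {M : Type*} [AddCommGroup M]

/-- The boundary operator of the augmented simplicial chain complex of the full simplex on `ι`. -/
def simplexBoundary (c : Finset ι → M) (G : Finset ι) : M :=
  ∑ i, faceSign i G • c (insert i G)

lemma simplexBoundary_simplexBoundary (c : Finset ι → M) :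
    simplexBoundary (simplexBoundary c) = 0 := by
  funext G
  simp only [simplexBoundary, Finset.smul_sum, smul_smul, Pi.zero_apply]
  rw [← Finset.sum_product']
  refine Finset.sum_involution (fun p _ => p.swap) ?_ ?_ ?_ ?_
  · rintro ⟨i, j⟩ -
    simp only [Prod.swap]
    rw [faceSign_mul_insert i j, Finset.insert_comm, neg_smul, neg_add_cancel]
  · rintro ⟨i, j⟩ - h heq
    obtain rfl : j = i := congrArg Prod.fst heq
    simp [faceSign_of_mem] at h
  · simp
  · simp

/-- The cone operator with apex `i`, a contracting homotopy for `simplexBoundary`. -/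
def simplexCone (i : ι) (c : Finset ι → M) (F : Finset ι) : M :=
  if i ∈ F then faceSign i (F.erase i) • c (F.erase i) else 0

lemma simplexBoundary_simplexCone (i : ι) {c : Finset ι → M} (hc : simplexBoundary c = 0) :
    simplexBoundary (simplexCone i c) = c := by
  funext G
  by_cases hi : i ∈ G
  · obtain ⟨F, hF, rfl⟩ : ∃ F, i ∉ F ∧ G = insert i F :=
      ⟨G.erase i, Finset.notMem_erase i G, (Finset.insert_erase hi).symm⟩
    have h0 : faceSign i F • simplexBoundary c F = 0 := by rw [hc]; simp
    rw [simplexBoundary, Finset.smul_sum, ← Finset.add_sum_erase _ _ (Finset.mem_univ i), smul_smul,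
      faceSign_mul_self hF, one_smul] at h0
    rw [simplexBoundary, ← Finset.add_sum_erase _ _ (Finset.mem_univ i),
      faceSign_of_mem (Finset.mem_insert_self i F), zero_smul, zero_add,
      eq_neg_of_add_eq_zero_left h0, ← Finset.sum_neg_distrib]
    refine Finset.sum_congr rfl fun j hj => ?_
    have hji : j ≠ i := Finset.ne_of_mem_erase hj
    rw [simplexCone, if_pos (by simp), Finset.insert_comm,
      Finset.erase_insert (by simp [hF, hji.symm]),
      smul_smul, smul_smul, faceSign_insert_mul_insert hji.symm hF, neg_smul]
  · rw [simplexBoundary, Finset.sum_eq_single i]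
    · rw [simplexCone, if_pos (Finset.mem_insert_self i G), Finset.erase_insert hi, smul_smul,
        faceSign_mul_self hi, one_smul]
    · intro j _ hj
      rw [simplexCone, if_neg (by simp [hi, hj.symm]), smul_zero]
    · simp


lemma simplexBoundary_map {N L : Type*} [AddCommGroup N] [FunLike L M N]
    [AddMonoidHomClass L M N] (f : L)
    (c : Finset ι → M) (G : Finset ι) :
    simplexBoundary (fun F => f (c F)) G = f (simplexBoundary c G) := by
  simp [simplexBoundary]

lemma simplexBoundary_sum {α : Type*} (s : Finset α) (c : α → Finset ι → M) :
    simplexBoundary (fun F => ∑ a ∈ s, c a F) = fun G => ∑ a ∈ s, simplexBoundary (c a) G := by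
  funext G
  simp only [simplexBoundary, Finset.smul_sum]
  exact Finset.sum_comm

end Simplex

section Exactness

variable {ι : Type*} [LinearOrder ι] [Fintype ι] {σ K : Type*} [CommRing K]

/-- The exponent of the squarefree monomial with support `s`. -/
noncomputable def sqfreeExp (s : Finset σ) : σ →₀ ℕ := ∑ v ∈ s, Finsupp.single v 1

lemma sqfreeExp_apply [DecidableEq σ] (s : Finset σ) (v : σ) :
    sqfreeExp s v = if v ∈ s then 1 else 0 := by
  simp [sqfreeExp, Finsupp.finsetSum_apply, Finsupp.single_apply]

lemma sqfreeExp_le_iff {s : Finset σ} {a : σ →₀ ℕ} : sqfreeExp s ≤ a ↔ s ⊆ a.support := by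
  classical
  refine ⟨fun h v hv => ?_, fun h v => ?_⟩
  · have := h v
    rw [sqfreeExp_apply, if_pos hv] at this
    simp; omega
  · rw [sqfreeExp_apply]
    split_ifs with hv
    · exact Nat.one_le_iff_ne_zero.2 (Finsupp.mem_support_iff.1 (h hv))
    · simp

lemma prod_X_eq_monomial (s : Finset σ) :
    ∏ v ∈ s, (X v : MvPolynomial σ K) = monomial (sqfreeExp s) 1 :=
  (monomial_sum_one s _).symm

lemma support_of_coeff_monomial_mul_ne_zero {s : Finset σ} {p : MvPolynomial σ K} {a : σ →₀ ℕ}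
    (h : coeff a (monomial (sqfreeExp s) 1 * p) ≠ 0) : s ⊆ a.support := by
  rw [coeff_monomial_mul'] at h
  exact sqfreeExp_le_iff.1 (by by_contra hs; simp [hs] at h)

lemma monomial_dvd_of_support {s : Finset σ} {a : σ →₀ ℕ} {c : K} (h : s ⊆ a.support) :
    monomial (sqfreeExp s) 1 ∣ monomial a c :=
  ⟨monomial (a - sqfreeExp s) c, by
    rw [monomial_mul, one_mul, add_tsub_cancel_of_le (sqfreeExp_le_iff.2 h)]⟩

variable [DecidableEq σ]

lemma exists_simplexBoundary_eq (A : ι → Finset σ) {k : ℕ} {C : Finset ι → MvPolynomial σ K}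
    (hcard : ∀ F, F.card ≠ k + 1 → C F = 0)
    (hsupp : ∀ F a, coeff a (C F) ≠ 0 → F.sup A ⊆ a.support)
    (hC : simplexBoundary C = 0) :
    ∃ E : Finset ι → MvPolynomial σ K, (∀ F, F.card ≠ k + 2 → E F = 0) ∧
      (∀ F, monomial (sqfreeExp (F.sup A)) 1 ∣ E F) ∧ simplexBoundary E = C := by
  have hcoeff (a : σ →₀ ℕ) : simplexBoundary (fun F => coeff a (C F)) = 0 := by
    funext G
    exact (simplexBoundary_map (coeffAddMonoidHom a) C G).trans (by simp [hC])
  have hex (a : σ →₀ ℕ) : ∃ h : Finset ι → K, (∀ F, F.card ≠ k + 2 → h F = 0) ∧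
      (∀ F, h F ≠ 0 → F.sup A ⊆ a.support) ∧ simplexBoundary h = fun F => coeff a (C F) := by
    by_cases hF : ∃ F, coeff a (C F) ≠ 0
    · obtain ⟨F, hF⟩ := hF
      have hFc : F.card = k + 1 := by
        by_contra h
        simp [hcard F h] at hF
      obtain ⟨i, hi⟩ : F.Nonempty := Finset.card_pos.1 (by omega)
      have hia : A i ⊆ a.support := (Finset.le_sup hi).trans (hsupp F a hF)
      refine ⟨simplexCone i fun F => coeff a (C F), fun G hG => ?_, fun G hG => ?_,
        simplexBoundary_simplexCone i (hcoeff a)⟩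
      · rw [simplexCone]
        split_ifs with h
        · rw [hcard _ (by rw [Finset.card_erase_of_mem h]; omega)]
          simp
        · rfl
      · rw [simplexCone] at hG
        split_ifs at hG with h
        · rw [← Finset.insert_erase h, Finset.sup_insert]
          refine sup_le hia (hsupp _ _ fun h0 => hG ?_)
          rw [h0, smul_zero]
        · exact absurd rfl hG
    · push Not at hF
      exact ⟨0, by simp, by simp, by funext G; simp [simplexBoundary, hF]⟩
  choose h hhcard hhsupp hh using hex
  classical
  let s : Finset (σ →₀ ℕ) := Finset.univ.biUnion fun F => (C F).support
  refine ⟨fun F => ∑ a ∈ s, monomial a (h a F), fun F hF => ?_, fun F => ?_, ?_⟩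
  · exact Finset.sum_eq_zero fun a _ => by rw [hhcard a F hF, map_zero]
  · refine Finset.dvd_sum fun a _ => ?_
    by_cases h0 : h a F = 0
    · simp [h0]
    · exact monomial_dvd_of_support (hhsupp a F h0)
  · funext G
    rw [simplexBoundary_sum s fun a F => monomial a (h a F)]
    have hG : (C G).support ⊆ s := Finset.subset_biUnion_of_mem (fun F => (C F).support)
      (Finset.mem_univ G)
    simp only [simplexBoundary_map (monomial _), hh]
    conv_rhs => rw [(C G).as_sum]
    refine (Finset.sum_subset hG fun a _ ha => ?_).symm
    rw [notMem_support_iff.1 ha, map_zero]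

end Exactness

section Taylor

variable {ι : Type*} [LinearOrder ι] [Fintype ι] {σ K : Type*} [DecidableEq σ] [CommRing K]
  (A : ι → Finset σ)

/-- The exponent of `lcm (insert i F) / lcm F`. -/
noncomputable def faceExp (i : ι) (F : Finset ι) : σ →₀ ℕ := sqfreeExp (A i \ F.sup A)

omit [Fintype ι] in
lemma sqfreeExp_sup_insert (i : ι) (F : Finset ι) :
    sqfreeExp ((insert i F).sup A) = sqfreeExp (F.sup A) + faceExp A i F := by
  ext v
  simp only [faceExp, Finsupp.add_apply, sqfreeExp_apply, Finset.sup_insert, Finset.sup_eq_union,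
    Finset.mem_union, Finset.mem_sdiff]
  split_ifs <;> simp_all

/-- The differential of the Taylor complex, on all faces at once. -/
noncomputable def taylorDiff :
    (Finset ι → MvPolynomial σ K) →ₗ[MvPolynomial σ K] (Finset ι → MvPolynomial σ K) where
  toFun c G := ∑ i, faceSign i G • (monomial (faceExp A i G) 1 * c (insert i G))
  map_add' c c' := by
    funext G
    simp [mul_add, Finset.sum_add_distrib]
  map_smul' p c := by
    funext G
    simp only [Pi.smul_apply, smul_eq_mul, Finset.mul_sum, RingHom.id_apply, mul_smul_comm]
    exact Finset.sum_congr rfl fun i _ => by rw [mul_left_comm]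

lemma taylorDiff_apply (c : Finset ι → MvPolynomial σ K) (G : Finset ι) :
    taylorDiff A c G = ∑ i, faceSign i G • (monomial (faceExp A i G) 1 * c (insert i G)) := rfl

lemma monomial_mul_taylorDiff (c : Finset ι → MvPolynomial σ K) (G : Finset ι) :
    monomial (sqfreeExp (G.sup A)) 1 * taylorDiff A c G =
      simplexBoundary (fun F => monomial (sqfreeExp (F.sup A)) 1 * c F) G := by
  simp only [taylorDiff_apply, simplexBoundary, Finset.mul_sum, mul_smul_comm]
  refine Finset.sum_congr rfl fun i _ => ?_
  rw [← mul_assoc, monomial_mul, one_mul, sqfreeExp_sup_insert]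

omit [DecidableEq σ] in
lemma monomial_mul_injective (a : σ →₀ ℕ) :
    Function.Injective fun p : MvPolynomial σ K => monomial a 1 * p := by
  intro p q h
  ext m
  have := congrArg (coeff (a + m)) h
  simpa using this

lemma taylorDiff_taylorDiff (c : Finset ι → MvPolynomial σ K) :
    taylorDiff A (taylorDiff A c) = 0 := by
  funext G
  apply monomial_mul_injective (sqfreeExp (G.sup A))
  dsimp only
  rw [monomial_mul_taylorDiff]
  simp only [monomial_mul_taylorDiff]
  exact (congrFun (simplexBoundary_simplexBoundary _) G).trans (by simp)

variable (σ K) in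
/-- The degree `k` part of the Taylor complex: functions supported on faces of cardinality `k`. -/
def taylorModule (ι : Type*) (k : ℕ) :
    Submodule (MvPolynomial σ K) (Finset ι → MvPolynomial σ K) where
  carrier := {c | ∀ F, F.card ≠ k → c F = 0}
  add_mem' hc hc' F hF := by simp [hc F hF, hc' F hF]
  zero_mem' F _ := rfl
  smul_mem' p c hc F hF := by simp [hc F hF]

variable (σ K) in
/-- The projection of functions on all faces to the functions supported on faces of
cardinality `k`. -/
noncomputable def taylorProj (ι : Type*) (k : ℕ) :
    (Finset ι → MvPolynomial σ K) →ₗ[MvPolynomial σ K] taylorModule σ K ι k where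
  toFun c := ⟨fun F => if F.card = k then c F else 0, fun F hF => if_neg hF⟩
  map_add' c c' := by ext F : 2; simp; split_ifs <;> simp
  map_smul' p c := by ext F : 2; simp

omit [LinearOrder ι] [Fintype ι] [DecidableEq σ] in
lemma taylorProj_coe {k : ℕ} (c : taylorModule σ K ι k) : taylorProj σ K ι k c = c := by
  ext F : 2
  by_cases hF : F.card = k
  · simp [taylorProj, hF]
  · simp [taylorProj, hF, c.2 F hF]

instance (k : ℕ) : Module.Projective (MvPolynomial σ K) (taylorModule σ K ι k) :=
  Module.Projective.of_split (taylorModule σ K ι k).subtype (taylorProj σ K ι k)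
    (LinearMap.ext taylorProj_coe)

lemma taylorDiff_mem (k : ℕ) {c : Finset ι → MvPolynomial σ K}
    (hc : c ∈ taylorModule σ K ι (k + 1)) :
    taylorDiff A c ∈ taylorModule σ K ι k := by
  intro G hG
  refine Finset.sum_eq_zero fun i _ => ?_
  by_cases hi : i ∈ G
  · rw [faceSign_of_mem hi, zero_smul]
  · rw [hc _ (by rw [Finset.card_insert_of_notMem hi]; omega), mul_zero, smul_zero]

variable (K) in
/-- The differential of the Taylor complex. -/
noncomputable def taylorD (k : ℕ) :
    taylorModule σ K ι (k + 1) →ₗ[MvPolynomial σ K] taylorModule σ K ι k :=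
  (taylorDiff A).restrict fun _ => taylorDiff_mem A k

lemma taylorD_exact (k : ℕ) : Function.Exact (taylorD K A (k + 1)) (taylorD K A k) := by
  rintro ⟨c, hc⟩
  constructor
  · intro h
    have h0 : taylorDiff A c = 0 := congrArg Subtype.val h
    obtain ⟨E, hE, hdvd, hEc⟩ := exists_simplexBoundary_eq A (k := k)
      (C := fun F => monomial (sqfreeExp (F.sup A)) 1 * c F)
      (fun F hF => by rw [hc F hF, mul_zero])
      (fun F a => support_of_coeff_monomial_mul_ne_zero)
      (by funext G; rw [← monomial_mul_taylorDiff, h0]; simp)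
    choose e he using hdvd
    refine ⟨⟨e, fun F hF => ?_⟩, Subtype.ext <| funext fun G => ?_⟩
    · apply monomial_mul_injective (sqfreeExp (F.sup A))
      simp [← he, hE F hF]
    · apply monomial_mul_injective (sqfreeExp (G.sup A))
      refine (monomial_mul_taylorDiff A e G).trans ?_
      simp only [← he]
      exact congrFun hEc G
  · rintro ⟨e, h⟩
    rw [← h]
    exact Subtype.ext (taylorDiff_taylorDiff A e.1)

variable (K) in
/-- The augmentation of the Taylor complex. -/
noncomputable def taylorAug (I : Ideal (MvPolynomial σ K)) :
    taylorModule σ K ι 0 →ₗ[MvPolynomial σ K] MvPolynomial σ K ⧸ I :=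
  I.mkQ ∘ₗ LinearMap.proj ∅ ∘ₗ (taylorModule σ K ι 0).subtype

omit [LinearOrder ι] [Fintype ι] [DecidableEq σ] in
lemma taylorAug_surjective (I : Ideal (MvPolynomial σ K)) :
    Function.Surjective (taylorAug (ι := ι) K I) := by
  intro x
  obtain ⟨p, rfl⟩ := I.mkQ_surjective x
  refine ⟨taylorProj σ K ι 0 fun _ => p, ?_⟩
  simp [taylorAug, taylorProj]

lemma taylorD_taylorAug_exact : Function.Exact (taylorD K A 0)
    (taylorAug K (Ideal.span (Set.range fun i => ∏ v ∈ A i, (X v : MvPolynomial σ K)))) := by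
  have hD (c : Finset ι → MvPolynomial σ K) :
      taylorDiff A c ∅ = ∑ i, c {i} * ∏ v ∈ A i, (X v : MvPolynomial σ K) := by
    rw [taylorDiff_apply]
    refine Finset.sum_congr rfl fun i _ => ?_
    simp [faceSign, faceExp, prod_X_eq_monomial, mul_comm]
  intro c
  have hI : taylorAug K
      (Ideal.span (Set.range fun i => ∏ v ∈ A i, (X v : MvPolynomial σ K))) c = 0 ↔
      c.1 ∅ ∈ Ideal.span (Set.range fun i => ∏ v ∈ A i, (X v : MvPolynomial σ K)) :=
    Submodule.Quotient.mk_eq_zero _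
  rw [hI, Ideal.mem_span_range_iff_exists_fun]
  constructor
  · rintro ⟨p, hp⟩
    refine ⟨taylorProj σ K ι 1 (∑ i, Pi.single {i} (p i)), Subtype.ext <| funext fun G => ?_⟩
    by_cases hG : G = ∅
    · subst hG
      refine (hD _).trans (Eq.trans ?_ hp)
      refine Finset.sum_congr rfl fun i _ => ?_
      simp [taylorProj, Pi.single_apply]
    · have hG' : G.card ≠ 0 := by simpa using hG
      rw [c.2 G hG']
      exact Subtype.property (taylorD K A 0 _) G hG'
  · rintro ⟨e, rfl⟩
    exact ⟨fun i => e.1 {i}, (hD e.1).symm⟩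

end Taylor

section Cohomology

variable {ι : Type*} [LinearOrder ι] [Fintype ι] {σ K : Type*} [DecidableEq σ] [CommRing K]
  (A : ι → Finset σ) {N : Type*} [AddCommGroup N] [Module (MvPolynomial σ K) N]

/-- The differential of the cochain complex of homomorphisms from the Taylor complex to `N`. -/
noncomputable def taylorCodiff (φ : Finset ι → N) (F : Finset ι) : N :=
  ∑ i ∈ F, faceSign i (F.erase i) •
    (monomial (faceExp A i (F.erase i)) 1 : MvPolynomial σ K) • φ (F.erase i)

lemma linearCombination_taylorDiff (φ : Finset ι → N) (c : Finset ι → MvPolynomial σ K) :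
    ∑ G, taylorDiff A c G • φ G = ∑ F, c F • taylorCodiff (K := K) A φ F := by
  simp only [taylorDiff_apply, taylorCodiff, Finset.sum_smul, Finset.smul_sum]
  rw [Finset.sum_sigma', Finset.sum_sigma']
  symm
  refine Finset.sum_of_injOn (fun p => ⟨p.1.erase p.2, p.2⟩) ?_ ?_ ?_ ?_
  · rintro ⟨F, i⟩ h ⟨F', i'⟩ h' heq
    simp only [Finset.coe_sigma, Set.mem_sigma_iff, Finset.mem_coe] at h h'
    simp only [Sigma.mk.injEq, heq_eq_eq] at heq
    obtain ⟨h1, rfl⟩ := heq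
    simp only [Sigma.mk.injEq, heq_eq_eq, and_true]
    rw [← Finset.insert_erase h.2, h1, Finset.insert_erase h'.2]
  · intro p _
    simp
  · rintro ⟨G, i⟩ - h
    have hi : i ∈ G := by
      by_contra hi
      exact h ⟨⟨insert i G, i⟩, by simp, by simp [Finset.erase_insert hi]⟩
    simp [faceSign_of_mem hi]
  · rintro ⟨F, i⟩ h
    simp only [Finset.mem_sigma, Finset.mem_univ, true_and] at h
    simp only [Finset.insert_erase h]
    rw [smul_comm, smul_smul, smul_assoc, mul_comm]

/-- Exactness at degree `k + 1` of the cochain complex of homomorphisms from the Taylor complex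
to `N`, in terms of values on basis elements. -/
lemma forall_exists_comp_taylorD_iff (k : ℕ) :
    (∀ f : taylorModule σ K ι (k + 1) →ₗ[MvPolynomial σ K] N, f ∘ₗ taylorD K A (k + 1) = 0 →
      ∃ g : taylorModule σ K ι k →ₗ[MvPolynomial σ K] N, g ∘ₗ taylorD K A k = f) ↔
    ∀ φ : Finset ι → N, (∀ F, F.card = k + 2 → taylorCodiff (K := K) A φ F = 0) →
      ∃ γ : Finset ι → N, ∀ F, F.card = k + 1 → taylorCodiff (K := K) A γ F = φ F := by
  classical
  let hom (k : ℕ) (φ : Finset ι → N) : taylorModule σ K ι k →ₗ[MvPolynomial σ K] N :=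
    Fintype.linearCombination (MvPolynomial σ K) φ ∘ₗ (taylorModule σ K ι k).subtype
  let val (k : ℕ) (f : taylorModule σ K ι k →ₗ[MvPolynomial σ K] N) (F : Finset ι) : N :=
    f (taylorProj σ K ι k (Pi.single F 1))
  have hom_val (k : ℕ) (f) : hom k (val k f) = f := by
    have : Fintype.linearCombination (MvPolynomial σ K) (val k f) = f ∘ₗ taylorProj σ K ι k := by
      refine LinearMap.pi_ext' fun F => LinearMap.ext_ring ?_
      simp [val]
    ext c
    exact (congrArg (fun f => f c.1) this).trans (congrArg f (taylorProj_coe c))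
  have val_hom (k : ℕ) (φ : Finset ι → N) (F : Finset ι) (hF : F.card = k) :
      val k (hom k φ) F = φ F := by
    have : (taylorProj σ K ι k (Pi.single F 1)).1 = Pi.single F 1 := by
      have hm : Pi.single F 1 ∈ taylorModule σ K ι k := fun G hG =>
        Pi.single_eq_of_ne (by rintro rfl; exact hG hF) _
      exact congrArg Subtype.val (taylorProj_coe ⟨_, hm⟩)
    change Fintype.linearCombination (MvPolynomial σ K) φ
      (taylorProj σ K ι k (Pi.single F 1)).1 = φ F
    simp [this]
  have hom_comp (k : ℕ) (φ : Finset ι → N) :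
      hom k φ ∘ₗ taylorD K A k = hom (k + 1) (taylorCodiff (K := K) A φ) :=
    LinearMap.ext fun c => linearCombination_taylorDiff A φ c.1
  have hom_eq_iff (k : ℕ) (φ ψ : Finset ι → N) :
      hom k φ = hom k ψ ↔ ∀ F, F.card = k → φ F = ψ F := by
    refine ⟨fun h F hF => by rw [← val_hom k φ F hF, h, val_hom k ψ F hF], fun h => ?_⟩
    ext c
    refine Finset.sum_congr rfl fun F _ => ?_
    by_cases hF : F.card = k
    · exact congrArg _ (h F hF)
    · change c.1 F • _ = c.1 F • _
      rw [c.2 F hF, zero_smul, zero_smul]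
  have hom_zero (k : ℕ) : hom k 0 = 0 := by
    ext c
    simp [hom, Fintype.linearCombination_apply]
  constructor
  · intro H φ hφ
    obtain ⟨g, hg⟩ := H (hom (k + 1) φ)
      (by rw [hom_comp, ← hom_zero, hom_eq_iff]; exact hφ)
    refine ⟨val k g, (hom_eq_iff (k + 1) _ _).1 ?_⟩
    rw [← hom_comp, hom_val, hg]
  · intro H f hf
    obtain ⟨γ, hγ⟩ := H (val (k + 1) f) (by
      rw [← hom_val (k + 1) f, hom_comp, ← hom_zero, hom_eq_iff] at hf
      exact hf)
    refine ⟨hom k γ, ?_⟩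
    rw [hom_comp, ← hom_val (k + 1) f]
    exact (hom_eq_iff _ _ _).2 hγ

end Cohomology

section Criteria

variable {ι : Type*} [LinearOrder ι] [Fintype ι] {σ : Type*} [DecidableEq σ]
  (A : ι → Finset σ)

/-- The exponent of the `i`-th entry of the last differential of the Taylor complex. -/
noncomputable def topExp (i : ι) : σ →₀ ℕ := faceExp A i (Finset.univ.erase i)

/-- The exponent of the entry of the second to last differential of the Taylor complex
at the faces omitting `i` and omitting `i` and `j`. -/
noncomputable def subtopExp (i j : ι) : σ →₀ ℕ := faceExp A j ((Finset.univ.erase i).erase j)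

/-- The relation on monomials in a free module with basis `ι` given by the second to last
differential of the Taylor complex. -/
inductive SubtopRel : (σ →₀ ℕ) × ι → (σ →₀ ℕ) × ι → Prop
  | mk (m : σ →₀ ℕ) {i j : ι} (hij : i ≠ j) :
      SubtopRel (m + subtopExp A i j, i) (m + subtopExp A j i, j)

/-- The combinatorial condition for the vanishing of the top two `Ext` modules. -/
def SubtopConnected : Prop :=
  ∃ i, topExp A i = 0 ∧
    ∀ j, Quot.mk (SubtopRel A) (0, j) = Quot.mk (SubtopRel A) (topExp A j, i)

section

variable {K : Type*} [CommRing K] {N : Type*} [AddCommGroup N] [Module (MvPolynomial σ K) N]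

variable (K) in
lemma exists_taylorCodiff_univ_eq {i : ι} (hi : topExp A i = 0) (ν : N) :
    ∃ γ : Finset ι → N, taylorCodiff (K := K) A γ Finset.univ = ν := by
  refine ⟨Pi.single (Finset.univ.erase i) (faceSign i (Finset.univ.erase i) • ν), ?_⟩
  rw [taylorCodiff, Finset.sum_eq_single i]
  · change _ • (monomial (topExp A i) 1 : MvPolynomial σ K) • _ = _
    rw [hi, ← C_apply, C_1, one_smul, Pi.single_eq_same, smul_smul,
      faceSign_mul_self (Finset.notMem_erase _ _), one_smul]
  · intro j _ hj
    rw [Pi.single_eq_of_ne, smul_zero, smul_zero]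
    exact fun h => hj (Finset.erase_injOn _ (Finset.mem_coe.2 (Finset.mem_univ j))
      (Finset.mem_coe.2 (Finset.mem_univ i)) h)
  · simp

lemma exists_topExp_eq_zero [Nontrivial K] {γ : Finset ι → MvPolynomial σ K}
    (h : taylorCodiff (K := K) A γ Finset.univ = 1) : ∃ i, topExp A i = 0 := by
  by_contra! hne
  have := congrArg constantCoeff h
  rw [taylorCodiff, map_sum, map_one] at this
  refine zero_ne_one (α := K) ((Finset.sum_eq_zero fun i _ => ?_).symm.trans this)
  rw [map_zsmul, smul_eq_mul, map_mul, constantCoeff_monomial]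
  rw [if_neg (show ¬faceExp A i _ = 0 from hne i), zero_mul, smul_zero]

lemma faceSign_mul_erase {i j : ι} (hij : i ≠ j) :
    faceSign i (Finset.univ.erase i) * faceSign j ((Finset.univ.erase i).erase j) =
      -(faceSign j (Finset.univ.erase j) * faceSign i ((Finset.univ.erase j).erase i)) := by
  have h1 : (Finset.univ.erase i : Finset ι) = insert j ((Finset.univ.erase i).erase j) :=
    (Finset.insert_erase (by simp [hij.symm])).symm
  have h2 : (Finset.univ.erase j : Finset ι) = insert i ((Finset.univ.erase i).erase j) := by
    rw [Finset.erase_right_comm, Finset.insert_erase (by simp [hij])]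
  have := faceSign_mul_insert j i ((Finset.univ.erase i).erase j)
  rw [← h1, ← h2] at this
  rw [Finset.erase_right_comm (a := j), mul_comm, this, mul_comm]

lemma eq_or_eq_of_erase_erase_eq {i j k l : ι}
    (h : (Finset.univ.erase k).erase l = (Finset.univ.erase i).erase j) : i = k ∨ i = l := by
  have : i ∉ (Finset.univ.erase k).erase l := by rw [h]; simp
  simp only [Finset.mem_erase, Finset.mem_univ, and_true] at this
  tauto

variable (K) in
/-- The normalized second to last differential of the cochain complex of homomorphisms from the
Taylor complex to the ring, as a map to a free module with basis `ι`. -/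
noncomputable def subtopCodiff :
    (Finset ι → MvPolynomial σ K) →ₗ[MvPolynomial σ K] (ι → MvPolynomial σ K) where
  toFun γ i := faceSign i (Finset.univ.erase i) • taylorCodiff (K := K) A γ (Finset.univ.erase i)
  map_add' γ γ' := by
    funext i
    simp [taylorCodiff, mul_add, Finset.sum_add_distrib]
  map_smul' p γ := by
    funext i
    simp only [taylorCodiff, Pi.smul_apply, smul_eq_mul, Finset.mul_sum, Finset.smul_sum,
      RingHom.id_apply, mul_smul_comm]
    exact Finset.sum_congr rfl fun i _ => by rw [mul_left_comm]

lemma subtopCodiff_apply (γ : Finset ι → MvPolynomial σ K) (i : ι) :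
    subtopCodiff A K γ i = ∑ j ∈ Finset.univ.erase i,
      (faceSign i (Finset.univ.erase i) * faceSign j ((Finset.univ.erase i).erase j)) •
        (monomial (subtopExp A i j) 1 * γ ((Finset.univ.erase i).erase j)) := by
  change faceSign i _ • taylorCodiff (K := K) A γ _ = _
  rw [taylorCodiff]
  simp only [Finset.smul_sum, smul_smul]
  rfl

lemma subtopCodiff_single {i j : ι} (hij : i ≠ j) (p : MvPolynomial σ K) :
    subtopCodiff A K (Pi.single ((Finset.univ.erase i).erase j)
      ((faceSign i (Finset.univ.erase i) * faceSign j ((Finset.univ.erase i).erase j)) • p)) =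
    Pi.single i (monomial (subtopExp A i j) 1 * p) -
      Pi.single j (monomial (subtopExp A j i) 1 * p) := by
  have hsq : (faceSign i (Finset.univ.erase i) * faceSign j ((Finset.univ.erase i).erase j)) *
      (faceSign i (Finset.univ.erase i) * faceSign j ((Finset.univ.erase i).erase j)) = 1 := by
    rw [mul_mul_mul_comm, faceSign_mul_self (by simp), faceSign_mul_self (by simp), one_mul]
  funext k
  rw [subtopCodiff_apply, Pi.sub_apply]
  by_cases hki : k = i
  · subst hki
    rw [Pi.single_eq_same, Pi.single_eq_of_ne hij, sub_zero,
      Finset.sum_eq_single_of_mem j (by simp [hij.symm])]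
    · rw [Pi.single_eq_same, mul_smul_comm, smul_smul, hsq, one_smul]
    · intro l hl hlj
      rw [Pi.single_eq_of_ne, mul_zero, smul_zero]
      intro h
      rw [Finset.erase_right_comm (a := k) (b := j)] at h
      rcases eq_or_eq_of_erase_erase_eq h with h | h
      · exact hij h.symm
      · exact hlj h.symm
  by_cases hkj : k = j
  · subst hkj
    rw [Pi.single_eq_same, Pi.single_eq_of_ne hki, zero_sub,
      Finset.sum_eq_single_of_mem i (by simp [hij])]
    · rw [Finset.erase_right_comm (a := k) (b := i), Pi.single_eq_same, mul_smul_comm, smul_smul,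
        ← Finset.erase_right_comm (a := k) (b := i), ← neg_neg (faceSign k _ * _),
        ← faceSign_mul_erase hij, neg_mul,
        Finset.erase_right_comm (a := k) (b := i), hsq, neg_smul, one_smul]
    · intro l hl hlj
      rw [Pi.single_eq_of_ne, mul_zero, smul_zero]
      intro h
      rcases eq_or_eq_of_erase_erase_eq h with h | h
      · exact hki h.symm
      · exact hlj h.symm
  rw [Pi.single_eq_of_ne hki, Pi.single_eq_of_ne hkj, sub_zero]
  refine Finset.sum_eq_zero fun l hl => ?_
  rw [Pi.single_eq_of_ne, mul_zero, smul_zero]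
  intro h
  have h1 := eq_or_eq_of_erase_erase_eq h
  rw [Finset.erase_right_comm (a := i)] at h
  have h2 := eq_or_eq_of_erase_erase_eq h
  grind

lemma single_sub_single_mem_range {p q : (σ →₀ ℕ) × ι}
    (h : Quot.mk (SubtopRel A) p = Quot.mk (SubtopRel A) q) :
    (Pi.single p.2 (monomial p.1 1) - Pi.single q.2 (monomial q.1 1) : ι → MvPolynomial σ K) ∈
      LinearMap.range (subtopCodiff A K) := by
  let cls (p : (σ →₀ ℕ) × ι) : (ι → MvPolynomial σ K) ⧸ LinearMap.range (subtopCodiff A K) :=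
    Submodule.Quotient.mk (Pi.single p.2 (monomial p.1 1))
  have hcls : ∀ p q, SubtopRel A p q → cls p = cls q := by
    rintro _ _ ⟨m, hij⟩
    refine (Submodule.Quotient.eq _).2 ⟨_, (subtopCodiff_single A hij (monomial m 1)).trans ?_⟩
    simp only [monomial_mul, one_mul, add_comm]
  exact (Submodule.Quotient.eq _).1 (congrArg (Quot.lift cls hcls) h)

lemma taylorCodiff_sum_smul (γ : ι → Finset ι → MvPolynomial σ K) (ν : ι → N) (F : Finset ι) :
    taylorCodiff (K := K) A (fun G => ∑ a, γ a G • ν a) F =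
      ∑ a, taylorCodiff (K := K) A (γ a) F • ν a := by
  simp only [taylorCodiff, Finset.smul_sum, Finset.sum_smul, smul_assoc]
  exact Finset.sum_comm

lemma SubtopConnected.exists_taylorCodiff_eq (h : SubtopConnected A) {φ : Finset ι → N}
    (hφ : taylorCodiff (K := K) A φ Finset.univ = 0) :
    ∃ γ : Finset ι → N, ∀ i,
      taylorCodiff (K := K) A γ (Finset.univ.erase i) = φ (Finset.univ.erase i) := by
  obtain ⟨i₀, -, h⟩ := h
  choose γ hγ using fun a => single_sub_single_mem_range (K := K) A (h a)
  let s (i : ι) : ℤ := faceSign i (Finset.univ.erase i)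
  have hs (i : ι) : s i * s i = 1 := faceSign_mul_self (Finset.notMem_erase _ _)
  have hφ' :
      ∑ a, (monomial (topExp A a) 1 : MvPolynomial σ K) • s a • φ (Finset.univ.erase a) = 0 := by
    rw [← hφ]
    exact Finset.sum_congr rfl fun a _ => smul_comm _ _ _
  refine ⟨fun G => ∑ a, γ a G • s a • φ (Finset.univ.erase a), fun i => ?_⟩
  have hγi (a : ι) : taylorCodiff (K := K) A (γ a) (Finset.univ.erase i) =
      s i • ((Pi.single a (monomial 0 1) - Pi.single i₀ (monomial (topExp A a) 1) :
        ι → MvPolynomial σ K) i) := by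
    rw [← hγ a]
    change _ = s i • s i • taylorCodiff (K := K) A (γ a) (Finset.univ.erase i)
    rw [smul_smul, hs, one_smul]
  rw [taylorCodiff_sum_smul]
  simp only [hγi, smul_assoc, ← Finset.smul_sum, Pi.sub_apply, sub_smul, Finset.sum_sub_distrib]
  have h1 : ∑ a, (Pi.single a (monomial 0 1) : ι → MvPolynomial σ K) i •
      s a • φ (Finset.univ.erase a) = s i • φ (Finset.univ.erase i) := by
    rw [Finset.sum_eq_single i]
    · rw [Pi.single_eq_same, ← C_apply, C_1, one_smul]
    · intro b _ hb
      rw [Pi.single_eq_of_ne hb.symm, zero_smul]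
    · simp
  have h2 : ∑ a, (Pi.single i₀ (monomial (topExp A a) 1) : ι → MvPolynomial σ K) i •
      s a • φ (Finset.univ.erase a) = 0 := by
    by_cases hi : i = i₀
    · subst hi
      simpa only [Pi.single_eq_same] using hφ'
    · simp only [Pi.single_eq_of_ne hi, zero_smul, Finset.sum_const_zero]
  rw [h1, h2, sub_zero, smul_smul, hs, one_smul]

end

section

variable {K : Type*} [CommRing K]

/-- The `K`-linear map to the free module on classes of monomials sending the monomial `m` in the
`i`-th coordinate to its class. -/
noncomputable def classMap (i : ι) :
    MvPolynomial σ K →ₗ[K] (Quot (SubtopRel A) →₀ K) :=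
  (basisMonomials σ K).constr K fun m => Finsupp.single (Quot.mk _ (m, i)) 1

lemma classMap_monomial (i : ι) (m : σ →₀ ℕ) :
    classMap (K := K) A i (monomial m 1) = Finsupp.single (Quot.mk _ (m, i)) 1 := by
  have := (basisMonomials σ K).constr_basis K
    (fun m => (Finsupp.single (Quot.mk (SubtopRel A) (m, i)) 1 : Quot (SubtopRel A) →₀ K)) m
  rwa [coe_basisMonomials] at this

lemma classMap_monomial_mul {i j : ι} (hij : i ≠ j) (p : MvPolynomial σ K) :
    classMap A i (monomial (subtopExp A i j) 1 * p) =
      classMap A j (monomial (subtopExp A j i) 1 * p) := by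
  have : classMap A i ∘ₗ LinearMap.mulLeft K (monomial (subtopExp A i j) (1 : K)) =
      classMap A j ∘ₗ LinearMap.mulLeft K (monomial (subtopExp A j i) (1 : K)) := by
    refine (basisMonomials σ K).ext fun m => ?_
    simp only [coe_basisMonomials, LinearMap.comp_apply, LinearMap.mulLeft_apply, monomial_mul,
      one_mul, classMap_monomial]
    rw [add_comm, add_comm (subtopExp A j i), Quot.sound (SubtopRel.mk m hij)]
  exact LinearMap.congr_fun this p

lemma sum_classMap_subtopCodiff (γ : Finset ι → MvPolynomial σ K) :
    ∑ i, classMap A i (subtopCodiff A K γ i) = 0 := by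
  simp only [subtopCodiff_apply, map_sum, map_zsmul]
  rw [Finset.sum_sigma']
  refine Finset.sum_involution (fun p _ => ⟨p.2, p.1⟩) ?_ ?_ ?_ ?_
  · rintro ⟨i, j⟩ h
    have hij : i ≠ j := by simpa [eq_comm] using h
    dsimp only
    rw [faceSign_mul_erase hij, classMap_monomial_mul A hij,
      Finset.erase_right_comm (a := i) (b := j), neg_smul, neg_add_cancel]
  · rintro ⟨i, j⟩ h - heq
    simp only [Sigma.mk.injEq] at heq
    simp [heq.1] at h
  · rintro ⟨i, j⟩ h
    simpa [eq_comm] using h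
  · rintro ⟨i, j⟩ h
    rfl

lemma SubtopConnected.of_exists [Nontrivial K] {i₀ : ι} (hi₀ : topExp A i₀ = 0)
    (H : ∀ φ : Finset ι → MvPolynomial σ K, taylorCodiff (K := K) A φ Finset.univ = 0 →
      ∃ γ : Finset ι → MvPolynomial σ K, ∀ i,
        taylorCodiff (K := K) A γ (Finset.univ.erase i) = φ (Finset.univ.erase i)) :
    SubtopConnected A := by
  refine ⟨i₀, hi₀, fun a => ?_⟩
  let s (i : ι) : ℤ := faceSign i (Finset.univ.erase i)
  have hs (i : ι) : s i * s i = 1 := faceSign_mul_self (Finset.notMem_erase _ _)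
  let n : ι → MvPolynomial σ K := Pi.single a 1 - Pi.single i₀ (monomial (topExp A a) 1)
  let φ : Finset ι → MvPolynomial σ K := fun F => ∑ i ∈ Fᶜ, s i • n i
  have hφ (i : ι) : φ (Finset.univ.erase i) = s i • n i := by
    have : ((Finset.univ : Finset ι).erase i)ᶜ = {i} := by ext; simp
    simp [φ, this]
  obtain ⟨γ, hγ⟩ := H φ (by
    have (i : ι) : faceSign i (Finset.univ.erase i) •
        (monomial (faceExp A i (Finset.univ.erase i)) 1 : MvPolynomial σ K) •
          φ (Finset.univ.erase i) = monomial (topExp A i) 1 * n i := by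
      rw [hφ, smul_eq_mul, mul_smul_comm, smul_smul]
      exact (congrArg (· • _) (hs i)).trans (one_smul _ _)
    simp only [taylorCodiff, this, n, Pi.sub_apply, mul_sub, Finset.sum_sub_distrib]
    simp [Pi.single_apply, hi₀])
  have hn : subtopCodiff A K γ = n := by
    funext i
    change s i • taylorCodiff (K := K) A γ _ = n i
    rw [hγ, hφ, smul_smul, hs, one_smul]
  have h0 := sum_classMap_subtopCodiff A γ
  simp only [hn, n, Pi.sub_apply, map_sub, Finset.sum_sub_distrib] at h0
  have hsum (i : ι) (p : MvPolynomial σ K) :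
      ∑ j, classMap A j ((Pi.single i p : ι → MvPolynomial σ K) j) = classMap A i p := by
    rw [Finset.sum_eq_single i]
    · rw [Pi.single_eq_same]
    · intro b _ hb
      rw [Pi.single_eq_of_ne hb, map_zero]
    · simp
  rw [hsum, hsum, sub_eq_zero, ← C_1, C_apply, classMap_monomial, classMap_monomial] at h0
  exact Finsupp.single_left_injective one_ne_zero h0

end

end Criteria

lemma pdim_le_iff {R : Type u} [CommRing R] {M : ModuleCat.{u} R} (d : ℕ) :
    pdim R M ≤ d ↔ ∀ k : ℕ, d < k → ∀ N : ModuleCat.{u} R,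
      Subsingleton (((Ext R (ModuleCat.{u} R) k).obj (Opposite.op M)).obj N) := by
  constructor
  · intro h k hk N
    have hmem : pdim R M ∈ {n : ℕ∞ | ∀ k : ℕ, n < (k : ℕ∞) → ∀ N : ModuleCat.{u} R,
        Subsingleton (((Ext R (ModuleCat.{u} R) k).obj (Opposite.op M)).obj N)} :=
      csInf_mem ⟨⊤, fun k hk => absurd hk not_top_lt⟩
    exact hmem k (h.trans_lt (by exact_mod_cast hk)) N
  · intro h
    exact sInf_le fun k hk N => h k (by exact_mod_cast hk) N

section SquarefreeMonomialIdeal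

variable {K : Type u} [Field K] {n μ : ℕ} (A : Fin μ → Finset (Fin n))

lemma subsingleton_Ext_succ_sqfIdeal_iff (k : ℕ) (N : ModuleCat.{u} (MvPolynomial (Fin n) K)) :
    Subsingleton (((Ext (MvPolynomial (Fin n) K) (ModuleCat.{u} (MvPolynomial (Fin n) K))
      (k + 1)).obj (Opposite.op (ModuleCat.of (MvPolynomial (Fin n) K)
        (MvPolynomial (Fin n) K ⧸ sqfIdeal K A)))).obj N) ↔
    ∀ φ : Finset (Fin μ) → N, (∀ F, F.card = k + 2 → taylorCodiff (K := K) A φ F = 0) →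
      ∃ γ : Finset (Fin μ) → N, ∀ F, F.card = k + 1 → taylorCodiff (K := K) A γ F = φ F :=
  (subsingleton_Ext_succ_iff (T := fun k => taylorModule (Fin n) K (Fin μ) k) (d := taylorD K A)
    (taylorD_exact A) (taylorD_taylorAug_exact A) (taylorAug_surjective _) k N).trans
    (forall_exists_comp_taylorD_iff (K := K) (N := N) A k)

lemma subsingleton_Ext_sqfIdeal_of_lt {k : ℕ} (hk : μ < k)
    (N : ModuleCat.{u} (MvPolynomial (Fin n) K)) :
    Subsingleton (((Ext (MvPolynomial (Fin n) K) (ModuleCat.{u} (MvPolynomial (Fin n) K))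
      k).obj (Opposite.op (ModuleCat.of (MvPolynomial (Fin n) K)
        (MvPolynomial (Fin n) K ⧸ sqfIdeal K A)))).obj N) := by
  obtain ⟨k, rfl⟩ := Nat.exists_eq_succ_of_ne_zero (Nat.ne_zero_of_lt hk)
  rw [subsingleton_Ext_succ_sqfIdeal_iff]
  refine fun φ _ => ⟨φ, fun F hF => ?_⟩
  have := F.card_le_univ
  rw [Fintype.card_fin] at this
  omega

variable (K) in
lemma pdim_le_sub_one_iff (hμ : 1 ≤ μ) :
    pdim (MvPolynomial (Fin n) K) (ModuleCat.of (MvPolynomial (Fin n) K)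
      (MvPolynomial (Fin n) K ⧸ sqfIdeal K A)) ≤ (μ - 1 : ℕ) ↔ ∃ i, topExp A i = 0 := by
  obtain ⟨k, rfl⟩ := Nat.exists_eq_add_of_le' hμ
  have hcard (F : Finset (Fin (k + 1))) : F.card = k + 1 ↔ F = Finset.univ := by
    rw [← Finset.card_eq_iff_eq_univ, Fintype.card_fin]
  have hcard' (F : Finset (Fin (k + 1))) : F.card ≠ k + 2 := by
    have := F.card_le_univ
    rw [Fintype.card_fin] at this
    omega
  rw [pdim_le_iff]
  constructor
  · intro h
    obtain ⟨γ, hγ⟩ := (subsingleton_Ext_succ_sqfIdeal_iff A k (ModuleCat.of _ _)).1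
      (h (k + 1) (by omega) (ModuleCat.of _ (MvPolynomial (Fin n) K))) (fun _ => 1)
      fun F hF => absurd hF (hcard' F)
    exact exists_topExp_eq_zero A (hγ Finset.univ ((hcard _).2 rfl))
  · rintro ⟨i, hi⟩ l hl N
    rcases (show k + 1 ≤ l by omega).eq_or_lt with rfl | hl
    · rw [subsingleton_Ext_succ_sqfIdeal_iff]
      intro φ _
      obtain ⟨γ, hγ⟩ := exists_taylorCodiff_univ_eq A K hi (φ Finset.univ)
      refine ⟨γ, fun F hF => ?_⟩
      obtain rfl := (hcard F).1 hF
      exact hγ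
    · exact subsingleton_Ext_sqfIdeal_of_lt A hl N

variable (K) in
lemma pdim_le_sub_two_iff (hμ : 2 ≤ μ) :
    pdim (MvPolynomial (Fin n) K) (ModuleCat.of (MvPolynomial (Fin n) K)
      (MvPolynomial (Fin n) K ⧸ sqfIdeal K A)) ≤ (μ - 2 : ℕ) ↔ SubtopConnected A := by
  obtain ⟨k, rfl⟩ := Nat.exists_eq_add_of_le' hμ
  have hcard (F : Finset (Fin (k + 2))) : F.card = k + 2 ↔ F = Finset.univ := by
    rw [← Finset.card_eq_iff_eq_univ, Fintype.card_fin]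
  have hcard' (F : Finset (Fin (k + 2))) : F.card = k + 1 ↔ ∃ i, F = Finset.univ.erase i := by
    constructor
    · intro hF
      obtain ⟨i, hi⟩ := Finset.card_eq_one.1 (show Fᶜ.card = 1 by
        rw [Finset.card_compl, Fintype.card_fin]; omega)
      refine ⟨i, ?_⟩
      rw [← compl_compl F, hi]
      ext; simp
    · rintro ⟨i, rfl⟩
      simp
  have hext (N : ModuleCat.{u} (MvPolynomial (Fin n) K)) :=
    subsingleton_Ext_succ_sqfIdeal_iff A k N
  constructor
  · intro h
    obtain ⟨i, hi⟩ := (pdim_le_sub_one_iff K A (by omega)).1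
      (h.trans (by exact_mod_cast (by omega : k + 2 - 2 ≤ k + 2 - 1)))
    refine SubtopConnected.of_exists (K := K) A hi fun φ hφ => ?_
    obtain ⟨γ, hγ⟩ := (hext (ModuleCat.of _ _)).1
      ((pdim_le_iff _).1 h (k + 1) (by omega) (ModuleCat.of _ (MvPolynomial (Fin n) K))) φ
      fun F hF => by obtain rfl := (hcard F).1 hF; exact hφ
    exact ⟨γ, fun i => hγ _ ((hcard' _).2 ⟨i, rfl⟩)⟩
  · intro h
    rw [pdim_le_iff]
    intro l hl N
    rcases (show k + 1 ≤ l by omega).eq_or_lt with rfl | hl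
    · rw [hext]
      intro φ hφ
      obtain ⟨γ, hγ⟩ := h.exists_taylorCodiff_eq A (hφ Finset.univ ((hcard _).2 rfl))
      refine ⟨γ, fun F hF => ?_⟩
      obtain ⟨i, rfl⟩ := (hcard' F).1 hF
      exact hγ i
    · obtain ⟨i, hi, -⟩ := h
      exact (pdim_le_iff _).1 ((pdim_le_sub_one_iff K A (by omega)).2 ⟨i, hi⟩) l (by omega) N

variable (K) in
/-- The combinatorial characterization of `pd S/I = μ - 1`, which does not involve the field. -/
lemma pdim_eq_sub_one_iff :
    pdim (MvPolynomial (Fin n) K) (ModuleCat.of (MvPolynomial (Fin n) K)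
      (MvPolynomial (Fin n) K ⧸ sqfIdeal K A)) = (μ - 1 : ℕ) ↔
    (1 ≤ μ → ∃ i, topExp A i = 0) ∧ (2 ≤ μ → ¬ SubtopConnected A) := by
  rcases Nat.lt_or_ge μ 2 with hμ | hμ
  · have h0 : μ - 1 = 0 := by omega
    have hle : pdim (MvPolynomial (Fin n) K) (ModuleCat.of (MvPolynomial (Fin n) K)
        (MvPolynomial (Fin n) K ⧸ sqfIdeal K A)) = (μ - 1 : ℕ) ↔
        pdim (MvPolynomial (Fin n) K) (ModuleCat.of (MvPolynomial (Fin n) K)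
          (MvPolynomial (Fin n) K ⧸ sqfIdeal K A)) ≤ (μ - 1 : ℕ) := by
      rw [h0, Nat.cast_zero, nonpos_iff_eq_zero]
    rw [hle, and_iff_left fun h => absurd h hμ.not_ge]
    rcases Nat.eq_zero_or_pos μ with rfl | hμ'
    · exact iff_of_true ((pdim_le_iff 0).2 fun k hk => subsingleton_Ext_sqfIdeal_of_lt A hk)
        fun h => absurd h (by omega)
    · exact (pdim_le_sub_one_iff K A hμ').trans ⟨fun h _ => h, fun h => h hμ'⟩
  · rw [← pdim_le_sub_one_iff K A (by omega), ← pdim_le_sub_two_iff K A hμ]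
    obtain ⟨k, rfl⟩ := Nat.exists_eq_add_of_le' hμ
    simp only [show 1 ≤ k + 2 by omega, hμ, true_imp_iff,
      le_antisymm_iff (b := ((k + 2 - 1 : ℕ) : ℕ∞))]
    refine and_congr_right fun _ => ?_
    rw [not_le, show k + 2 - 1 = k + 2 - 2 + 1 by omega, Nat.cast_add_one,
      ENat.add_one_le_iff (ENat.natCast_ne_top _)]

end SquarefreeMonomialIdeal

theorem pdim_eq_mu_sub_one_field_independent
    (K : Type u) (K' : Type v) [Field K] [Field K'] (n μ : ℕ)
    (A : Fin μ → Finset (Fin n))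
    (hmin : ∀ i j : Fin μ, i ≠ j → ¬ A i ⊆ A j) :
    (pdim (MvPolynomial (Fin n) K)
        (ModuleCat.of (MvPolynomial (Fin n) K)
          (MvPolynomial (Fin n) K ⧸ sqfIdeal K A)) = ((μ - 1 : ℕ) : ℕ∞))
      ↔ (pdim (MvPolynomial (Fin n) K')
        (ModuleCat.of (MvPolynomial (Fin n) K')
          (MvPolynomial (Fin n) K' ⧸ sqfIdeal K' A)) = ((μ - 1 : ℕ) : ℕ∞)) :=
  (pdim_eq_sub_one_iff K A).trans (pdim_eq_sub_one_iff K' A).symm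
end
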